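/- For n ≥ 1, the number of permutations w of {1,...,n} with as(w) ≤ 5 equals (5^n − (2n−5)·3^n + 2(n^2 − 5n + 5))/16. -/

import Mathlib

/-- The list of values of a permutation of `Fin n` (0-indexed; relative order
is what matters). -/
def permList (n : ℕ) (w : Equiv.Perm (Fin n)) : List ℕ :=
  List.ofFn (fun i => (w i : ℕ))

/-- A list is alternating: `a > b < c > d < ⋯` (descents in even positions). -/
def IsAlt (l : List ℕ) : Prop :=
  ∀ i : ℕ, ∀ hi : i + 1 < l.length,
    if i % 2 = 0 then l.get ⟨i + 1, hi⟩ < l.get ⟨i, Nat.lt_of_succ_lt hi⟩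
    else l.get ⟨i, Nat.lt_of_succ_lt hi⟩ < l.get ⟨i + 1, hi⟩

/-- `asLen n w` : the maximum length of an alternating subsequence of `w`. -/
noncomputable def asLen (n : ℕ) (w : Equiv.Perm (Fin n)) : ℕ :=
  sSup {k | ∃ l : List ℕ, l.Sublist (permList n w) ∧ IsAlt l ∧ l.length = k}

/-- `aCount n k = #{w ∈ S_n : as(w) = k}`. -/
noncomputable def aCount (n k : ℕ) : ℕ :=
  Nat.card {w : Equiv.Perm (Fin n) // asLen n w = k}

/-- `bCount n k = #{w ∈ S_n : as(w) ≤ k}`. -/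
noncomputable def bCount (n k : ℕ) : ℕ :=
  Nat.card {w : Equiv.Perm (Fin n) // asLen n w ≤ k}

/-- The number of direction changes along `l` when `p` is reached going up (`true`) or down
(`false`) and `l` follows `p`. -/
def turns : Bool → ℕ → List ℕ → ℕ
  | _, _, [] => 0
  | true, p, x :: xs => if x < p then turns false x xs + 1 else turns true x xs
  | false, p, x :: xs => if p < x then turns true x xs + 1 else turns false x xs

/-- The number of up-down runs of a list, the list being preceded by a virtual minimum. -/
def upDownRuns : List ℕ → ℕ
  | [] => 0
  | x :: xs => turns true x xs + 1

/-- The list is strictly alternating after `p`, its first step going up or down as indicated. -/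
def AltFrom : Bool → ℕ → List ℕ → Prop
  | _, _, [] => True
  | true, p, x :: xs => p < x ∧ AltFrom false x xs
  | false, p, x :: xs => x < p ∧ AltFrom true x xs

theorem altFrom_iff (b : Bool) (p : ℕ) (l : List ℕ) :
    AltFrom b p l ↔ ∀ i : ℕ, ∀ hi : i + 1 < (p :: l).length,
      if i % 2 = cond b 1 0 then (p :: l)[i + 1] < (p :: l)[i]
      else (p :: l)[i] < (p :: l)[i + 1] := by
  induction l generalizing b p with
  | nil => simp [AltFrom]
  | cons x xs ih =>
    cases b
    · rw [AltFrom, ih]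
      constructor
      · rintro ⟨h0, h⟩ i hi
        cases i with
        | zero => simpa using h0
        | succ i =>
          have := h i (by simpa using hi)
          simpa [Nat.succ_mod_two_eq_zero_iff] using this
      · intro h
        refine ⟨by simpa using h 0 (by simp), fun i hi => ?_⟩
        have := h (i + 1) (by simpa using hi)
        simpa [Nat.succ_mod_two_eq_zero_iff] using this
    · rw [AltFrom, ih]
      constructor
      · rintro ⟨h0, h⟩ i hi
        cases i with
        | zero => simpa using h0
        | succ i =>
          have := h i (by simpa using hi)
          simpa [Nat.succ_mod_two_eq_one_iff] using this
      · intro h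
        refine ⟨by simpa using h 0 (by simp), fun i hi => ?_⟩
        have := h (i + 1) (by simpa using hi)
        simpa [Nat.succ_mod_two_eq_one_iff] using this

theorem isAlt_cons_iff (p : ℕ) (l : List ℕ) : IsAlt (p :: l) ↔ AltFrom false p l := by
  rw [altFrom_iff]; rfl

theorem turns_le_turns_not_add_one (b : Bool) (p : ℕ) (l : List ℕ) :
    turns b p l ≤ turns (!b) p l + 1 := by
  induction l generalizing p b with
  | nil => simp [turns]
  | cons x xs ih =>
    have h1 := ih true x
    have h2 := ih false x
    cases b <;> simp only [turns, Bool.not_true, Bool.not_false] at * <;> split_ifs <;> omega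

theorem turns_le_turns_cons (b : Bool) (p x : ℕ) (l : List ℕ) :
    turns b p l ≤ turns b p (x :: l) := by
  cases l with
  | nil => simp [turns]
  | cons y ys =>
    have h1 := turns_le_turns_not_add_one true y ys
    have h2 := turns_le_turns_not_add_one false y ys
    cases b <;> simp only [turns, Bool.not_true, Bool.not_false] at * <;> split_ifs <;> omega

theorem turns_le_of_sublist {s l : List ℕ} (h : s.Sublist l) (b : Bool) (p : ℕ) :
    turns b p s ≤ turns b p l := by
  induction h generalizing b p with
  | slnil => rfl
  | cons x _ ih => exact (ih b p).trans (turns_le_turns_cons b p x _)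
  | cons_cons x _ ih =>
    have h1 := ih true x
    have h2 := ih false x
    cases b <;> simp only [turns] <;> split_ifs <;> omega

theorem upDownRuns_le_of_sublist {s l : List ℕ} (h : s.Sublist l) :
    upDownRuns s ≤ upDownRuns l := by
  induction h with
  | slnil => rfl
  | @cons _ l x _ ih =>
    refine ih.trans ?_
    cases l with
    | nil => simp [upDownRuns]
    | cons y ys =>
      have := turns_le_turns_not_add_one true y ys
      simp only [upDownRuns, turns, Bool.not_true] at *
      split_ifs <;> omega
  | cons_cons x h _ => exact Nat.succ_le_succ (turns_le_of_sublist h true x)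

theorem AltFrom.turns_eq_length {b : Bool} {p : ℕ} {l : List ℕ} (h : AltFrom b p l) :
    turns (!b) p l = l.length := by
  induction l generalizing b p with
  | nil => simp [turns]
  | cons x xs ih =>
    cases b
    · simpa [turns, h.1] using ih h.2
    · simpa [turns, h.1] using ih h.2

theorem IsAlt.upDownRuns_eq_length {l : List ℕ} (h : IsAlt l) : upDownRuns l = l.length := by
  cases l with
  | nil => rfl
  | cons x xs => simpa [upDownRuns] using ((isAlt_cons_iff x xs).1 h).turns_eq_length

theorem exists_altFrom_sublist (l : List ℕ) (p : ℕ) :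
    (∃ q s, p ≤ q ∧ (q :: s).Sublist (p :: l) ∧ AltFrom false q s ∧
      s.length = turns true p l) ∧
    (∃ q s, q ≤ p ∧ (q :: s).Sublist (p :: l) ∧ AltFrom true q s ∧
      s.length = turns false p l) := by
  induction l generalizing p with
  | nil => exact ⟨⟨p, [], by simp [AltFrom, turns]⟩, ⟨p, [], by simp [AltFrom, turns]⟩⟩
  | cons x xs ih =>
    obtain ⟨⟨q, s, hq, hs, ha, hl⟩, ⟨q', s', hq', hs', ha', hl'⟩⟩ := ih x
    constructor
    · by_cases h : x < p
      · exact ⟨p, q' :: s', le_rfl, hs'.cons_cons p, ⟨by omega, ha'⟩, by simp [turns, h, hl']⟩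
      · exact ⟨q, s, by omega, hs.cons p, ha, by simp [turns, h, hl]⟩
    · by_cases h : p < x
      · exact ⟨p, q :: s, le_rfl, hs.cons_cons p, ⟨by omega, ha⟩, by simp [turns, h, hl]⟩
      · exact ⟨q', s', by omega, hs'.cons p, ha', by simp [turns, h, hl']⟩

theorem exists_isAlt_sublist (l : List ℕ) :
    ∃ s : List ℕ, s.Sublist l ∧ IsAlt s ∧ s.length = upDownRuns l := by
  cases l with
  | nil => exact ⟨[], List.Sublist.refl _, fun i hi => absurd hi (by simp), rfl⟩
  | cons x xs =>
    obtain ⟨q, s, -, hs, ha, hl⟩ := (exists_altFrom_sublist xs x).1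
    exact ⟨q :: s, hs, (isAlt_cons_iff q s).2 ha, by simp [upDownRuns, hl]⟩

theorem asLen_eq_upDownRuns (n : ℕ) (w : Equiv.Perm (Fin n)) :
    asLen n w = upDownRuns (permList n w) := by
  refine IsGreatest.csSup_eq ⟨exists_isAlt_sublist _, ?_⟩
  rintro k ⟨l, hl, ha, rfl⟩
  exact ha.upDownRuns_eq_length ▸ upDownRuns_le_of_sublist hl

open List in
/-- How the number of turns is distributed when a new maximum is inserted in all positions. -/
theorem sum_turns_permutations'Aux (m : ℕ) (l : List ℕ) (p : ℕ) (g : ℕ → ℤ)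
    (hpm : p < m) (hlm : ∀ x ∈ l, x < m) (hnd : (p :: l).Nodup) :
    ((permutations'Aux m l).map fun s => g (turns true p s)).sum + g (turns false p l + 1) =
        (turns true p l + 1) * g (turns true p l) + g (turns true p l + 1) +
          (l.length - turns true p l) * g (turns true p l + 2) ∧
    ((permutations'Aux m l).map fun s => g (turns false p s)).sum =
        turns false p l * g (turns false p l) + g (turns false p l + 1) +
          (l.length - turns false p l) * g (turns false p l + 2) := by
  induction l generalizing p g with
  | nil => simp [permutations'Aux, turns, hpm, hpm.not_gt]
  | cons x xs ih =>
    have hxm : x < m := hlm x (by simp)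
    have hne : p ≠ x := fun h => by simp [h] at hnd
    have ih' := fun g => ih x g hxm (fun y hy => hlm y (by simp [hy])) hnd.of_cons
    have e0 := ih' g
    have e1 := ih' fun k => g (k + 1)
    simp only [permutations'Aux, map_cons, map_map, sum_cons, Function.comp_def, length_cons,
      turns, hpm, hpm.not_gt, hxm, hxm.not_gt, if_true, if_false] at *
    push_cast
    rcases hne.lt_or_gt with h | h
    · simp only [h, h.not_gt, if_true, if_false]
      exact ⟨by linear_combination e0.1, by linear_combination e1.1⟩
    · simp only [h, h.not_gt, if_true, if_false]
      exact ⟨by linear_combination e1.2, by linear_combination e0.2⟩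

open List in
theorem sum_upDownRuns_permutations'Aux (m : ℕ) (l : List ℕ) (g : ℕ → ℤ)
    (hlm : ∀ x ∈ l, x < m) (hnd : l.Nodup) :
    ((permutations'Aux m l).map fun s => g (upDownRuns s)).sum =
      upDownRuns l * g (upDownRuns l) + g (upDownRuns l + 1) +
        (l.length - upDownRuns l) * g (upDownRuns l + 2) := by
  cases l with
  | nil => simp [permutations'Aux, upDownRuns, turns]
  | cons x xs =>
    have hxm : x < m := hlm x (by simp)
    have e := (sum_turns_permutations'Aux m xs x (fun k => g (k + 1)) hxm
      (fun y hy => hlm y (by simp [hy])) hnd).1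
    simp only [permutations'Aux, map_cons, map_map, sum_cons, Function.comp_def, length_cons,
      turns, upDownRuns, hxm, if_true]
    push_cast
    linear_combination e

/-- The sum of `g` over the numbers of up-down runs of all arrangements of `0, …, n - 1`. -/
def runSum (n : ℕ) (g : ℕ → ℤ) : ℤ :=
  ((List.range n).reverse.permutations'.map fun l => g (upDownRuns l)).sum

theorem runSum_zero (g : ℕ → ℤ) : runSum 0 g = g 0 := by
  simp [runSum, upDownRuns]

theorem runSum_succ (n : ℕ) (g : ℕ → ℤ) :
    runSum (n + 1) g = runSum n fun k => k * g k + g (k + 1) + (n - k) * g (k + 2) := by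
  simp only [runSum, List.range_succ, List.reverse_append, List.reverse_singleton,
    List.singleton_append, List.permutations', List.flatMap_def, List.map_flatten,
    List.sum_flatten, List.map_map]
  congr 1
  refine List.map_congr_left fun l hl => ?_
  have hp : l.Perm (List.range n) :=
    (List.mem_permutations'.1 hl).trans (List.reverse_perm _)
  have := sum_upDownRuns_permutations'Aux n l g
    (fun x hx => List.mem_range.1 (hp.mem_iff.1 hx)) (hp.nodup_iff.2 List.nodup_range)
  simpa [hp.length_eq, Function.comp_def] using this

theorem runSum_add (n : ℕ) (f g : ℕ → ℤ) :
    runSum n (fun k => f k + g k) = runSum n f + runSum n g := by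
  simp [runSum, List.sum_map_add]

theorem runSum_const_mul (n : ℕ) (c : ℤ) (g : ℕ → ℤ) :
    runSum n (fun k => c * g k) = c * runSum n g := by
  simp [runSum, List.sum_map_mul_left]

theorem permList_injective (n : ℕ) : Function.Injective (permList n) := by
  intro v w h
  ext i
  exact congrFun (List.ofFn_injective h) i

theorem permList_perm (n : ℕ) (w : Equiv.Perm (Fin n)) :
    (permList n w).Perm (List.range n) := by
  refine (List.perm_ext_iff_of_nodup ?_ List.nodup_range).2 fun x => ?_
  · exact List.nodup_ofFn.2 (Fin.val_injective.comp w.injective)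
  · rw [permList, List.mem_ofFn, List.mem_range]
    constructor
    · rintro ⟨i, rfl⟩
      exact (w i).2
    · exact fun hx => ⟨w.symm ⟨x, hx⟩, by simp⟩

theorem image_permList (n : ℕ) :
    Finset.univ.image (permList n) = (List.range n).reverse.permutations'.toFinset := by
  refine Finset.eq_of_subset_of_card_le (fun l hl => ?_) ?_
  · obtain ⟨w, -, rfl⟩ := Finset.mem_image.1 hl
    rw [List.mem_toFinset, List.mem_permutations']
    exact (permList_perm n w).trans (List.reverse_perm _).symm
  · refine (List.toFinset_card_le _).trans ?_
    rw [Finset.card_image_of_injective _ (permList_injective n), Finset.card_univ,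
      Fintype.card_perm, ← (List.permutations_perm_permutations' _).length_eq]
    simp [List.length_permutations]

theorem sum_asLen_eq_runSum (n : ℕ) (g : ℕ → ℤ) :
    ∑ w : Equiv.Perm (Fin n), g (asLen n w) = runSum n g := by
  simp only [asLen_eq_upDownRuns]
  rw [← Finset.sum_image (f := fun l => g (upDownRuns l)) (permList_injective n).injOn,
    image_permList, List.sum_toFinset, runSum]
  rw [← (List.permutations_perm_permutations' _).nodup_iff]
  exact List.nodup_permutations _ (List.nodup_reverse.2 List.nodup_range)

theorem bCount_eq_runSum (n k : ℕ) :
    (bCount n k : ℤ) = runSum n fun j => if j ≤ k then 1 else 0 := by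
  classical
  rw [← sum_asLen_eq_runSum, bCount, Nat.card_eq_fintype_card, Fintype.card_subtype]
  simp

/-- The number of arrangements of `0, …, n - 1` with exactly `k` up-down runs. -/
def runCount (n k : ℕ) : ℤ := runSum n fun j => if j = k then 1 else 0

theorem runCount_succ_zero (n : ℕ) : runCount (n + 1) 0 = 0 := by
  have h : ∀ k : ℕ, (k : ℤ) * (if k = 0 then 1 else 0) = 0 := by simp
  rw [runCount, runSum_succ]
  simp [h, runSum]

theorem runCount_succ_one (n : ℕ) : runCount (n + 1) 1 = runCount n 1 + runCount n 0 := by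
  rw [runCount, runSum_succ, runCount, runCount, ← runSum_add]
  congr 1
  funext j
  rcases j with _ | _ | j <;> simp

theorem runCount_succ_add_two (n k : ℕ) :
    runCount (n + 1) (k + 2) =
      (k + 2) * runCount n (k + 2) + runCount n (k + 1) + (n - k) * runCount n k := by
  simp only [runCount, runSum_succ, ← runSum_add, ← runSum_const_mul]
  congr 1
  funext j
  simp only [Nat.add_right_cancel_iff]
  split_ifs <;> omega

theorem bCount_eq_sum_runCount (n k : ℕ) :
    (bCount n k : ℤ) = ∑ i ∈ Finset.range (k + 1), runCount n i := by
  rw [bCount_eq_runSum]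
  induction k with
  | zero => simp [runCount]
  | succ k ih =>
    rw [Finset.sum_range_succ, ← ih, runCount, ← runSum_add]
    congr 1
    funext j
    split_ifs <;> omega

theorem runCount_closed_forms (n : ℕ) :
    runCount (n + 1) 1 = 1 ∧
    runCount (n + 1) 2 = 2 ^ n - 1 ∧
    4 * runCount (n + 1) 3 = 3 * 3 ^ n - 2 * n + 1 - 4 * 2 ^ n ∧
    8 * runCount (n + 1) 4 =
      4 * 4 ^ n - (2 * n - 2) * 2 * 2 ^ n - 2 * (3 * 3 ^ n - 2 * n + 1) ∧
    16 * runCount (n + 1) 5 =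
      5 * 5 ^ n - (2 * n - 3) * 3 * 3 ^ n + 2 * ((n + 1) ^ 2 - 5 * (n + 1) + 5) -
        2 * (4 * 4 ^ n - (2 * n - 2) * 2 * 2 ^ n) := by
  induction n with
  | zero =>
    norm_num [runCount_succ_one, runCount_succ_add_two _ 0, runCount_succ_add_two _ 1,
      runCount_succ_add_two _ 2, runCount_succ_add_two _ 3]
    simp [runCount, runSum_zero]
  | succ n ih =>
    obtain ⟨h1, h2, h3, h4, h5⟩ := ih
    rw [runCount_succ_one (n + 1), runCount_succ_add_two (n + 1) 0,
      runCount_succ_add_two (n + 1) 1, runCount_succ_add_two (n + 1) 2,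
      runCount_succ_add_two (n + 1) 3, runCount_succ_zero]
    simp only [Nat.reduceAdd]
    push_cast
    refine ⟨?_, ?_, ?_, ?_, ?_⟩
    · linear_combination h1
    · linear_combination 2 * h2 + h1
    · linear_combination 3 * h3 + 4 * h2 + 4 * n * h1
    · linear_combination 4 * h4 + 2 * h3 + 8 * (n - 1) * h2
    · linear_combination 5 * h5 + 2 * h4 + 4 * (n - 2) * h3

theorem bCount_five (n : ℕ) (hn : 1 ≤ n) :
    (16 * bCount n 5 : ℤ) =
      5 ^ n - (2 * (n : ℤ) - 5) * 3 ^ n +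
        2 * ((n : ℤ) ^ 2 - 5 * n + 5) := by
  obtain ⟨n, rfl⟩ := Nat.exists_eq_add_of_le' hn
  obtain ⟨h1, h2, h3, h4, h5⟩ := runCount_closed_forms n
  rw [bCount_eq_sum_runCount]
  simp only [Finset.sum_range_succ, Finset.sum_range_zero, runCount_succ_zero]
  push_cast
  linear_combination 16 * h1 + 16 * h2 + 4 * h3 + 2 * h4 + h5
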